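/- arXiv:1110.2953 — 5 statements merged into one kernel-verified Lean document; each statement's English description precedes it below -/
import Mathlib

section
/- Let A and B be finite nonempty sets, and for i = 1, …, m let R_i^A be a k_i-ary relation on A all of whose tuples have pairwise distinct entries, and let R_i^B be a k_i-ary relation on B. Then there exists a function h : A → B with Val(h) ≥ Σ_{i=1}^{m} |R_i^A| · |R_i^B| / |B|^{k_i}; in particular Val(h) ≥ (min_{i} |R_i^B| / |B|^{k_i}) · Σ_{i=1}^{m} |R_i^A|. -/
/-- `Val RA RB h` : the total number of tuples, over all relations `RA i`,
satisfied by the assignment `h` (a tuple `t ∈ RA i` is satisfied if `h ∘ t ∈ RB i`). -/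
def Val {A B : Type} [DecidableEq B] {m : ℕ} {k : Fin m → ℕ}
    (RA : ∀ i, Finset (Fin (k i) → A)) (RB : ∀ i, Finset (Fin (k i) → B))
    (h : A → B) : ℕ :=
  ∑ i, ((RA i).filter (fun t => (h ∘ t) ∈ RB i)).card

/-- If `t : ι → A` is injective, a uniformly random `h : A → B` makes `h ∘ t` uniform on `ι → B`. -/
theorem card_filter_comp_mem_mul {ι A B : Type*} [Fintype ι] [Fintype A] [DecidableEq A]
    [Fintype B] [DecidableEq B] {t : ι → A} (ht : Function.Injective t) (S : Finset (ι → B)) :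
    (Finset.univ.filter fun h : A → B => h ∘ t ∈ S).card * Fintype.card B ^ Fintype.card ι =
      S.card * Fintype.card (A → B) := by
  classical
  let C := {a : A // a ∉ Set.range t}
  let σ : ι ⊕ C ≃ A :=
    ((Equiv.ofInjective t ht).sumCongr (Equiv.refl C)).trans (Equiv.sumCompl (· ∈ Set.range t))
  let e : (A → B) ≃ (ι → B) × (C → B) :=
    (σ.symm.arrowCongr (Equiv.refl B)).trans (Equiv.sumArrowEquivProdArrow ι C B)
  have he : ∀ h : A → B, (e h).1 = h ∘ t := fun h => rfl
  have hcard : (Finset.univ.filter fun h : A → B => h ∘ t ∈ S).card =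
      (S ×ˢ (Finset.univ : Finset (C → B))).card :=
    Finset.card_equiv e fun h => by simp [← he]
  rw [hcard, Finset.card_product, Finset.card_univ, Fintype.card_congr e, Fintype.card_prod,
    Fintype.card_fun (α := ι)]
  ring

/-- The total of `Val` over all assignments. -/
theorem sum_val {A B : Type} [Fintype A] [DecidableEq A] [Fintype B] [DecidableEq B]
    [Nonempty B] {m : ℕ} {k : Fin m → ℕ}
    (RA : ∀ i, Finset (Fin (k i) → A)) (RB : ∀ i, Finset (Fin (k i) → B))
    (hdist : ∀ i, ∀ t ∈ RA i, Function.Injective t) :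
    ∑ h : A → B, (Val RA RB h : ℚ) = Fintype.card (A → B) *
      ∑ i, ((RA i).card : ℚ) * (RB i).card / (Fintype.card B : ℚ) ^ (k i) := by
  have hB : (Fintype.card B : ℚ) ≠ 0 := Nat.cast_ne_zero.mpr Fintype.card_ne_zero
  simp only [Val, Nat.cast_sum]
  rw [Finset.sum_comm, Finset.mul_sum]
  refine Finset.sum_congr rfl fun i _ => ?_
  have key : ∀ t ∈ RA i, ((Finset.univ.filter fun h : A → B => h ∘ t ∈ RB i).card : ℚ) =
      (RB i).card * Fintype.card (A → B) / (Fintype.card B : ℚ) ^ (k i) := fun t ht => by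
    rw [eq_div_iff (pow_ne_zero _ hB)]
    exact_mod_cast Fintype.card_fin (k i) ▸ card_filter_comp_mem_mul (hdist i t ht) (RB i)
  have hswap : ∑ h : A → B, ((RA i).filter fun t => h ∘ t ∈ RB i).card =
      ∑ t ∈ RA i, (Finset.univ.filter fun h : A → B => h ∘ t ∈ RB i).card :=
    Finset.sum_card_bipartiteAbove_eq_sum_card_bipartiteBelow fun (h : A → B) t => h ∘ t ∈ RB i
  rw [← Nat.cast_sum, hswap, Nat.cast_sum, Finset.sum_congr rfl key, Finset.sum_const,
    nsmul_eq_mul]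
  ring

theorem stmt_2 {A B : Type} [Fintype A] [DecidableEq A] [Fintype B] [DecidableEq B]
    [Nonempty A] [Nonempty B] (m : ℕ) (hm : 0 < m) (k : Fin m → ℕ)
    (RA : ∀ i, Finset (Fin (k i) → A)) (RB : ∀ i, Finset (Fin (k i) → B))
    (hdist : ∀ i, ∀ t ∈ RA i, Function.Injective t) :
    ∃ h : A → B,
      (Val RA RB h : ℚ)
          ≥ ∑ i, ((RA i).card : ℚ) * (RB i).card / (Fintype.card B : ℚ) ^ (k i) ∧
      (Val RA RB h : ℚ)
          ≥ (Finset.univ.inf' ⟨⟨0, hm⟩, Finset.mem_univ _⟩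
              (fun i => ((RB i).card : ℚ) / (Fintype.card B : ℚ) ^ (k i)))
            * ∑ i, ((RA i).card : ℚ) := by
  obtain ⟨h, -, hh⟩ := Finset.exists_le_of_sum_le
    (s := (Finset.univ : Finset (A → B)))
    (f := fun _ => ∑ i, ((RA i).card : ℚ) * (RB i).card / (Fintype.card B : ℚ) ^ (k i))
    (g := fun h => (Val RA RB h : ℚ)) Finset.univ_nonempty
    (by rw [sum_val RA RB hdist, Finset.sum_const, nsmul_eq_mul, Finset.card_univ])
  refine ⟨h, hh, le_trans ?_ hh⟩
  rw [Finset.mul_sum]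
  refine Finset.sum_le_sum fun i hi => ?_
  rw [mul_div_assoc, mul_comm]
  gcongr
  exact Finset.inf'_le _ hi
end

section
/- Let A and B be finite sets with |A| ≥ |B|, let h : A → B, and let T = { x ∈ A : ∃ y ∈ A, y ≠ x and h(x) = h(y) }. Then there exists a surjective function h* : A → B such that the set D = { x ∈ A : h*(x) ≠ h(x) } satisfies D ⊆ T, |D| = |B| − |h(A)|, h* is injective on D, and h*(D) = B \ h(A). -/
theorem stmt_8 {A B : Type} [Fintype A] [DecidableEq A] [Fintype B] [DecidableEq B]
    (hBA : Fintype.card B ≤ Fintype.card A) (h : A → B)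
    (T : Finset A)
    (hT : T = Finset.univ.filter (fun x => ∃ y : A, y ≠ x ∧ h x = h y)) :
    ∃ hstar : A → B, Function.Surjective hstar ∧
      ∀ D : Finset A, D = Finset.univ.filter (fun x => hstar x ≠ h x) →
        D ⊆ T ∧
        D.card = Fintype.card B - (Finset.univ.image h).card ∧
        Set.InjOn hstar ↑D ∧
        D.image hstar = Finset.univ \ Finset.univ.image h := by
  -- `R` picks one representative from each nonempty fibre of `h`.
  obtain ⟨R, hR⟩ : ∃ R : Finset A, Set.BijOn h ↑R (Set.range h) := by
    obtain ⟨R, -, hR⟩ := (Set.surjOn_image h Set.univ).exists_bijOn_subset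
    exact ⟨R.toFinite.toFinset, by simpa using hR⟩
  have rep (x : A) : ∃ r ∈ R, h r = h x := hR.surjOn ⟨x, rfl⟩
  have hcard : R.card = (Finset.univ.image h).card := by
    rw [← Finset.card_image_of_injOn hR.injOn]
    congr 1
    ext b
    simpa using Set.ext_iff.mp hR.image_eq b
  obtain ⟨S, hSR, hS⟩ : ∃ S ⊆ Rᶜ, S.card = ((Finset.univ.image h)ᶜ).card := by
    apply Finset.exists_subset_card_eq
    rw [Finset.card_compl, Finset.card_compl, hcard]
    omega
  have hSR' : ∀ x ∈ S, x ∉ R := fun x hx => Finset.mem_compl.mp (hSR hx)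
  let e := Finset.equivOfCardEq hS
  let g : A → B := fun x => if hx : x ∈ S then e ⟨x, hx⟩ else h x
  have g_mem (x : A) (hx : x ∈ S) : g x = e ⟨x, hx⟩ := dif_pos hx
  have g_not_mem (x : A) (hx : x ∉ S) : g x = h x := dif_neg hx
  have g_not_range (x : A) (hx : x ∈ S) (y : A) : g x ≠ h y := by
    intro hxy
    have := (e ⟨x, hx⟩).2
    rw [← g_mem x hx, hxy] at this
    simp at this
  have g_hits (b : B) (hb : b ∉ Finset.univ.image h) : ∃ x ∈ S, g x = b := by
    let x := e.symm ⟨b, Finset.mem_compl.mpr hb⟩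
    exact ⟨x, x.2, by rw [g_mem _ x.2]; simp [x]⟩
  refine ⟨g, fun b => ?_, fun D hD => ?_⟩
  · by_cases hb : b ∈ Finset.univ.image h
    · obtain ⟨x, -, rfl⟩ := Finset.mem_image.mp hb
      obtain ⟨r, hr, hrx⟩ := rep x
      exact ⟨r, (g_not_mem r fun hrS => hSR' r hrS hr).trans hrx⟩
    · obtain ⟨x, -, hx⟩ := g_hits b hb
      exact ⟨x, hx⟩
  · have hDS : D = S := by
      ext x
      rw [hD, Finset.mem_filter_univ]
      exact ⟨fun hx => by_contra fun hxS => hx (g_not_mem x hxS), fun hx => g_not_range x hx x⟩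
    subst hDS
    refine ⟨fun x hx => ?_, by rw [hS, Finset.card_compl], fun x hx y hy hxy => ?_, ?_⟩
    · obtain ⟨r, hr, hrx⟩ := rep x
      rw [hT, Finset.mem_filter_univ]
      exact ⟨r, fun hrx' => hSR' x hx (hrx' ▸ hr), hrx.symm⟩
    · rw [g_mem x hx, g_mem y hy] at hxy
      simpa using e.injective (Subtype.ext hxy)
    · ext b
      rw [Finset.mem_image, Finset.mem_sdiff]
      constructor
      · rintro ⟨x, hx, rfl⟩
        simpa using fun y => (g_not_range x hx y).symm
      · exact fun hb => g_hits b hb.2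
end

section
/- Let A and B be finite sets with |A| > |B| ≥ 1, and for i = 1, …, m let R_i^A be a k_i-ary relation on A and R_i^B a k_i-ary relation on B; let k_max = max_i k_i. Then for every function h : A → B there exists a surjective function h* : A → B with Val(h*) ≥ (1 − k_max · |B| / (|A| − |B|)) · Val(h) (as an inequality of rational numbers). -/
/-- Among the `n`-element subsets of `s`, some subset has average weight at most that of `s`. -/
theorem exists_subset_card_eq_card_mul_sum_le {α : Type*} [DecidableEq α] (w : α → ℕ) (n : ℕ)
    (s : Finset α) (hn : n ≤ s.card) :
    ∃ T ⊆ s, T.card = n ∧ s.card * ∑ a ∈ T, w a ≤ n * ∑ a ∈ s, w a := by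
  induction hs : s.card generalizing s with
  | zero =>
    exact ⟨∅, by simp, by simp; omega, by simp⟩
  | succ c ih =>
    rcases hn.eq_or_lt with h | h
    · exact ⟨s, subset_rfl, h.symm, by rw [h, hs]⟩
    · obtain ⟨x, hx, hmax⟩ := s.exists_max_image w (Finset.card_pos.mp (by omega))
      have hc : (s.erase x).card = c := by rw [Finset.card_erase_of_mem hx]; omega
      obtain ⟨T, hT, hTn, hle⟩ := ih (s.erase x) (by omega) hc
      have hTs : T ⊆ s := hT.trans (Finset.erase_subset _ _)
      refine ⟨T, hTs, hTn, ?_⟩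
      have hTx : ∑ a ∈ T, w a ≤ n * w x := by
        simpa [hTn] using Finset.sum_le_card_nsmul T w (w x) fun a ha => hmax a (hTs ha)
      rw [← Finset.add_sum_erase s w hx]
      linarith

/-- The number of tuples satisfied by `h` in which the element `a` occurs. -/
def satisfiedDegree {A B : Type} [DecidableEq A] [DecidableEq B] {m : ℕ} {k : Fin m → ℕ}
    (RA : ∀ i, Finset (Fin (k i) → A)) (RB : ∀ i, Finset (Fin (k i) → B))
    (h : A → B) (a : A) : ℕ :=
  ∑ i, (((RA i).filter (fun t => (h ∘ t) ∈ RB i)).filter (fun t => ∃ j, t j = a)).card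

theorem sum_satisfiedDegree_le {A B : Type} [DecidableEq A] [DecidableEq B] {m : ℕ}
    {k : Fin m → ℕ} (RA : ∀ i, Finset (Fin (k i) → A)) (RB : ∀ i, Finset (Fin (k i) → B))
    (h : A → B) (U : Finset A) (K : ℕ) (hK : ∀ i, k i ≤ K) :
    ∑ a ∈ U, satisfiedDegree RA RB h a ≤ K * Val RA RB h := by
  unfold satisfiedDegree Val
  rw [Finset.sum_comm, Finset.mul_sum]
  refine Finset.sum_le_sum fun i _ => ?_
  simp_rw [Finset.card_filter (fun t : Fin (k i) → A => ∃ j, t j = _)]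
  rw [Finset.sum_comm, mul_comm]
  refine Finset.sum_le_card_nsmul _ _ _ fun t _ => ?_
  rw [← Finset.card_filter]
  calc (U.filter fun a => ∃ j, t j = a).card ≤ (Finset.univ.image t).card :=
        Finset.card_le_card fun a ha => by simpa using (Finset.mem_filter.mp ha).2
    _ ≤ k i := by simpa using Finset.card_image_le (s := Finset.univ) (f := t)
    _ ≤ K := hK i

/-- Changing an assignment on `T` loses only satisfied tuples that meet `T`. -/
theorem Val_le_add_sum_satisfiedDegree {A B : Type} [DecidableEq A] [DecidableEq B] {m : ℕ}
    {k : Fin m → ℕ} (RA : ∀ i, Finset (Fin (k i) → A)) (RB : ∀ i, Finset (Fin (k i) → B))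
    (h g : A → B) (T : Finset A) (hg : ∀ a ∉ T, g a = h a) :
    Val RA RB h ≤ Val RA RB g + ∑ a ∈ T, satisfiedDegree RA RB h a := by
  unfold satisfiedDegree Val
  rw [Finset.sum_comm, ← Finset.sum_add_distrib]
  refine Finset.sum_le_sum fun i _ => ?_
  set F := (RA i).filter (fun t => (h ∘ t) ∈ RB i) with hF
  set G := (RA i).filter (fun t => (g ∘ t) ∈ RB i) with hG
  have hsub : F ⊆ G ∪ T.biUnion fun a => F.filter (fun t => ∃ j, t j = a) := by
    intro t ht
    rw [Finset.mem_union]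
    by_cases hT : ∃ j, t j ∈ T
    · obtain ⟨j, hj⟩ := hT
      exact .inr (Finset.mem_biUnion.mpr ⟨t j, hj, Finset.mem_filter.mpr ⟨ht, j, rfl⟩⟩)
    · left
      have hgt : g ∘ t = h ∘ t := funext fun j => hg _ fun hj => hT ⟨j, hj⟩
      rw [hF, Finset.mem_filter] at ht
      rwa [hG, Finset.mem_filter, hgt]
  calc F.card ≤ _ := Finset.card_le_card hsub
    _ ≤ _ := Finset.card_union_le _ _
    _ ≤ _ := Nat.add_le_add_left Finset.card_biUnion_le _

/-- An assignment can be made surjective by changing it on at most `|B|` elements, chosen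
of small total weight. -/
theorem exists_surjective_eq_off_light {A B : Type} [Fintype A] [DecidableEq A] [Fintype B]
    [DecidableEq B] (hBA : Fintype.card B ≤ Fintype.card A) (h : A → B) (w : A → ℕ) :
    ∃ (g : A → B) (T U : Finset A), Function.Surjective g ∧ (∀ a ∉ T, g a = h a) ∧
      T.card ≤ Fintype.card B ∧ Fintype.card A ≤ U.card + Fintype.card B ∧
      U.card * ∑ a ∈ T, w a ≤ T.card * ∑ a ∈ U, w a := by
  set I := Finset.univ.image h
  obtain ⟨S, hS, hSI⟩ : ∃ S : Finset A, S.card = I.card ∧ S.image h = I := by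
    obtain ⟨S, -, hinj, himg⟩ := Finset.exists_subset_injOn_image_eq_of_surjOn
      (f := h) Set.univ I fun b hb => by simpa [I] using hb
    exact ⟨S, by rw [← himg, Finset.card_image_of_injOn hinj], himg⟩
  have hIB : I.card ≤ Fintype.card B := I.card_le_univ
  have hU := S.card_compl
  have hI := I.card_compl
  obtain ⟨T, hTU, hTn, hle⟩ := exists_subset_card_eq_card_mul_sum_le w Iᶜ.card Sᶜ (by omega)
  let e := Finset.equivOfCardEq hTn
  refine ⟨fun a => if ha : a ∈ T then e ⟨a, ha⟩ else h a, T, Sᶜ, fun b => ?_,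
    fun a ha => dif_neg ha, by omega, by omega, by rwa [hTn]⟩
  by_cases hb : b ∈ I
  · obtain ⟨a, ha, rfl⟩ := Finset.mem_image.mp (hSI ▸ hb)
    exact ⟨a, dif_neg fun haT => Finset.mem_compl.mp (hTU haT) ha⟩
  · refine ⟨e.symm ⟨b, Finset.mem_compl.mpr hb⟩, ?_⟩
    simp

theorem stmt_10 {A B : Type} [Fintype A] [DecidableEq A] [Fintype B] [DecidableEq B]
    (hBA : Fintype.card B < Fintype.card A) (hB : 1 ≤ Fintype.card B)
    (m : ℕ) (hm : 0 < m) (k : Fin m → ℕ)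
    (RA : ∀ i, Finset (Fin (k i) → A)) (RB : ∀ i, Finset (Fin (k i) → B))
    (kmax : ℕ) (hkmax : kmax = Finset.univ.sup' ⟨⟨0, hm⟩, Finset.mem_univ _⟩ k) :
    ∀ h : A → B, ∃ hstar : A → B, Function.Surjective hstar ∧
      (Val RA RB hstar : ℚ)
        ≥ (1 - (kmax : ℚ) * (Fintype.card B : ℚ)
              / ((Fintype.card A : ℚ) - (Fintype.card B : ℚ)))
          * (Val RA RB h : ℚ) := by
  intro h
  obtain ⟨g, T, U, hsurj, hg, hT, hU, hle⟩ :=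
    exists_surjective_eq_off_light hBA.le h (satisfiedDegree RA RB h)
  refine ⟨g, hsurj, ?_⟩
  have hK : ∀ i, k i ≤ kmax := fun i => hkmax ▸ Finset.le_sup' k (Finset.mem_univ i)
  have hloss := Val_le_add_sum_satisfiedDegree RA RB h g T hg
  have hsum := sum_satisfiedDegree_le RA RB h U kmax hK
  set L := ∑ a ∈ T, satisfiedDegree RA RB h a
  have hUL : U.card * L ≤ Fintype.card B * (kmax * Val RA RB h) :=
    hle.trans (Nat.mul_le_mul hT hsum)
  have hd : (0 : ℚ) < (Fintype.card A : ℚ) - Fintype.card B :=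
    sub_pos.mpr (by exact_mod_cast hBA)
  have hL : (L : ℚ) ≤ (kmax : ℚ) * Fintype.card B / ((Fintype.card A : ℚ) - Fintype.card B)
      * Val RA RB h := by
    rw [div_mul_eq_mul_div, le_div_iff₀ hd]
    have hU' : (Fintype.card A : ℚ) - Fintype.card B ≤ U.card :=
      sub_le_iff_le_add.mpr (by exact_mod_cast hU)
    have hUL' : (U.card : ℚ) * L ≤ Fintype.card B * (kmax * Val RA RB h) := by
      exact_mod_cast hUL
    nlinarith [mul_le_mul_of_nonneg_right hU' (Nat.cast_nonneg (α := ℚ) L)]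
  have hloss' : (Val RA RB h : ℚ) ≤ Val RA RB g + L := by exact_mod_cast hloss
  linarith
end

section
/- Let A and B be finite sets with B nonempty, and for i = 1, …, m let R_i^A be a k_i-ary relation on A and R_i^B a k_i-ary relation on B. Let A' = A ⊕ P be the disjoint sum of A with a set P of |B| fresh elements, and let R_i^{A'} = { inl ∘ t : t ∈ R_i^A }. Then the maximum of Val_{A'}(h') over all surjective functions h' : A' → B equals the maximum of Val_A(h) over all (not necessarily surjective) functions h : A → B. -/
theorem Val_image_inl {A B P : Type} [DecidableEq A] [DecidableEq B] [DecidableEq P]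
    {m : ℕ} {k : Fin m → ℕ}
    (RA : ∀ i, Finset (Fin (k i) → A)) (RB : ∀ i, Finset (Fin (k i) → B)) (h : A ⊕ P → B) :
    Val (fun i => (RA i).image (fun t => (Sum.inl ∘ t : Fin (k i) → A ⊕ P))) RB h
      = Val RA RB (h ∘ Sum.inl) := by
  refine Finset.sum_congr rfl fun i _ => ?_
  rw [Finset.filter_image, Finset.card_image_of_injective _ Sum.inl_injective.comp_left]
  rfl

theorem stmt_12 {A B P : Type} [Fintype A] [DecidableEq A] [Fintype B] [DecidableEq B]
    [Fintype P] [DecidableEq P] [Nonempty B]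
    (hP : Fintype.card P = Fintype.card B)
    (m : ℕ) (k : Fin m → ℕ)
    (RA : ∀ i, Finset (Fin (k i) → A)) (RB : ∀ i, Finset (Fin (k i) → B))
    (RA' : ∀ i, Finset (Fin (k i) → A ⊕ P))
    (hRA' : ∀ i, RA' i = (RA i).image (fun t => Sum.inl ∘ t)) :
    (Finset.univ.filter (fun h' : A ⊕ P → B => Function.Surjective h')).sup
        (fun h' => Val RA' RB h')
      = Finset.univ.sup (fun h : A → B => Val RA RB h) := by
  obtain rfl : RA' = fun i => (RA i).image (fun t => Sum.inl ∘ t) := funext hRA'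
  apply le_antisymm
  · refine Finset.sup_le fun h' _ => ?_
    rw [Val_image_inl]
    exact Finset.le_sup (f := fun h : A → B => Val RA RB h) (Finset.mem_univ (h' ∘ Sum.inl))
  · refine Finset.sup_le fun h _ => ?_
    let e : P ≃ B := Fintype.equivOfCardEq hP
    have hsurj : Function.Surjective (Sum.elim h e) := fun b => ⟨Sum.inr (e.symm b), by simp⟩
    have hle := Finset.le_sup (f := fun h' : A ⊕ P → B =>
        Val (fun i => (RA i).image (fun t => (Sum.inl ∘ t : Fin (k i) → A ⊕ P))) RB h')
      (Finset.mem_filter.2 ⟨Finset.mem_univ _, hsurj⟩)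
    simpa only [Val_image_inl, Sum.elim_comp_inl] using hle
end

section
/- Let A be a finite set with |A| ≥ 2, and let E and D be finite sets of pairs of elements of A. Then there exists a surjective function h : A → {0,1} such that h(x) = h(y) for every (x,y) ∈ E, and h(x) = 1 or h(y) = 1 for every (x,y) ∈ D, if and only if there exists an equivalence class C of the equivalence relation generated by E with C ≠ A such that no pair (x,y) ∈ D has both x ∈ C and y ∈ C. -/
/-- A function that respects a relation respects the equivalence relation it generates. -/
theorem eq_of_eqvGen {α β : Type*} {r : α → α → Prop} {f : α → β}
    (hf : ∀ u v, r u v → f u = f v) {x y : α} (hxy : Relation.EqvGen r x y) : f x = f y := by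
  induction hxy with
  | rel u v huv => exact hf u v huv
  | refl => rfl
  | symm _ _ _ ih => exact ih.symm
  | trans _ _ _ _ _ ih₁ ih₂ => exact ih₁.trans ih₂

theorem stmt_13 {A : Type} [Fintype A] [DecidableEq A]
    (hA : 2 ≤ Fintype.card A) (E D : Finset (A × A)) :
    (∃ h : A → Fin 2, Function.Surjective h ∧
        (∀ p ∈ E, h p.1 = h p.2) ∧
        (∀ p ∈ D, h p.1 = 1 ∨ h p.2 = 1)) ↔
    (∃ a : A,
        {x : A | Relation.EqvGen (fun u v => (u, v) ∈ E) x a} ≠ (Set.univ : Set A) ∧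
        ∀ p ∈ D, ¬ (Relation.EqvGen (fun u v => (u, v) ∈ E) p.1 a ∧
                    Relation.EqvGen (fun u v => (u, v) ∈ E) p.2 a)) := by
  classical
  constructor
  · rintro ⟨h, hsurj, hE, hD⟩
    have hconst {x y : A} (hxy : Relation.EqvGen (fun u v => (u, v) ∈ E) x y) : h x = h y :=
      eq_of_eqvGen (fun u v huv => hE (u, v) huv) hxy
    obtain ⟨a, ha⟩ := hsurj 0
    obtain ⟨b, hb⟩ := hsurj 1
    refine ⟨a, fun huniv => ?_, fun p hp ⟨h₁, h₂⟩ => ?_⟩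
    · have hba : b ∈ {x : A | Relation.EqvGen (fun u v => (u, v) ∈ E) x a} :=
        huniv ▸ Set.mem_univ b
      have := hconst hba
      simp [ha, hb] at this
    · have := hD p hp
      simp [hconst h₁, hconst h₂, ha] at this
  · rintro ⟨a, hne, hD⟩
    obtain ⟨b, hb⟩ := (Set.ne_univ_iff_exists_notMem _).mp hne
    rw [Set.mem_ofPred_eq] at hb
    refine ⟨fun x => if Relation.EqvGen (fun u v => (u, v) ∈ E) x a then 0 else 1,
      fun i => ?_, fun p hp => ?_, fun p hp => ?_⟩
    · fin_cases i
      · exact ⟨a, if_pos (.refl a)⟩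
      · exact ⟨b, if_neg hb⟩
    · have hE : Relation.EqvGen (fun u v => (u, v) ∈ E) p.1 p.2 := .rel _ _ hp
      have hiff : Relation.EqvGen (fun u v => (u, v) ∈ E) p.1 a ↔
          Relation.EqvGen (fun u v => (u, v) ∈ E) p.2 a :=
        ⟨(hE.symm _ _).trans _ _ _, hE.trans _ _ _⟩
      simp only [hiff]
    · rcases not_and_or.mp (hD p hp) with h₁ | h₂
      · exact .inl (if_neg h₁)
      · exact .inr (if_neg h₂)
end
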